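/- Let n = 3r and let (C, C̄) be an equitable partition of Q_n with quotient matrix [[0,3r],[r,2r]] such that C is semilinear, i.e., the affine rank of C is at most n−1. Then there exists an equitable partition (C_0, C_1, C_2, C_3) of Q_n with quotient matrix [[0,r,r,r],[r,0,r,r],[r,r,0,r],[r,r,r,0]] such that C_0 = C. -/

import Mathlib

/-- Binary words of length `n`: the vertex set of the hypercube `Q_n`. -/
abbrev BW (n : ℕ) := Fin n → ZMod 2

/-- Adjacency in a Hamming-type graph (hypercube `Q_n`, Hamming graph `H(r,q)`, ...):
two words are adjacent iff they differ in exactly one coordinate. -/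
def hAdj {ι : Type*} {β : ι → Type*} [Fintype ι] [∀ i, DecidableEq (β i)]
    (x y : ∀ i, β i) : Prop :=
  hammingDist x y = 1

/-- `(Cs i)_{i < k}` is an equitable partition of the graph with vertex set `V` and
adjacency relation `adj`, with quotient matrix `S`: the cells are nonempty, every vertex
lies in exactly one cell, and every vertex of `Cs i` has exactly `S i j` neighbors in `Cs j`. -/
def IsEquitablePartition {V : Type*} (adj : V → V → Prop) {k : ℕ}
    (Cs : Fin k → Set V) (S : Fin k → Fin k → ℕ) : Prop :=
  (∀ i, (Cs i).Nonempty) ∧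
  (∀ v : V, ∃! i, v ∈ Cs i) ∧
  ∀ i j : Fin k, ∀ v ∈ Cs i, {w | w ∈ Cs j ∧ adj v w}.ncard = S i j

/-- The affine rank of a subset of `F_2^n`: the dimension of its affine span. -/
noncomputable def affRank {N : ℕ} (s : Set (BW N)) : ℕ :=
  Module.finrank (ZMod 2) (affineSpan (ZMod 2) s).direction

open Classical in
/-- Number of neighbors of `v` in `A`. -/
noncomputable def nbc {n : ℕ} (v : BW n) (A : Set (BW n)) : ℕ :=
  (Finset.univ.filter (fun k : Fin n => v + Pi.single k 1 ∈ A)).card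

lemma zmod2_cases (a : ZMod 2) : a = 0 ∨ a = 1 := by
  revert a; decide

lemma zmod2_ne : ∀ a b : ZMod 2, a ≠ b → b = a + 1 := by decide

lemma zmod2_ne3 : ∀ a b c : ZMod 2, a ≠ b → (a + c ≠ b ↔ ¬ (c ≠ 0)) := by decide

lemma fin4_unique (a b c d : Prop) (h : (a ∧ ¬b ∧ ¬c ∧ ¬d) ∨ (¬a ∧ b ∧ ¬c ∧ ¬d) ∨
    (¬a ∧ ¬b ∧ c ∧ ¬d) ∨ (¬a ∧ ¬b ∧ ¬c ∧ d)) : ∃! j : Fin 4, (![a, b, c, d] j) := by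
  rcases h with h | h | h | h
  · refine ⟨0, h.1, fun j hj => ?_⟩
    fin_cases j
    exacts [rfl, absurd hj h.2.1, absurd hj h.2.2.1, absurd hj h.2.2.2]
  · refine ⟨1, h.2.1, fun j hj => ?_⟩
    fin_cases j
    exacts [absurd hj h.1, rfl, absurd hj h.2.2.1, absurd hj h.2.2.2]
  · refine ⟨2, h.2.2.1, fun j hj => ?_⟩
    fin_cases j
    exacts [absurd hj h.1, absurd hj h.2.1, rfl, absurd hj h.2.2.2]
  · refine ⟨3, h.2.2.2, fun j hj => ?_⟩
    fin_cases j
    exacts [absurd hj h.1, absurd hj h.2.1, absurd hj h.2.2.1, rfl]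

lemma hAdj_iff {n : ℕ} (v w : BW n) : hAdj v w ↔ ∃ k, w = v + Pi.single k 1 := by
  unfold hAdj hammingDist
  rw [Finset.card_eq_one]
  constructor
  · rintro ⟨k, hk⟩
    refine ⟨k, funext fun j => ?_⟩
    have hj := Finset.ext_iff.1 hk j
    simp only [Finset.mem_filter, Finset.mem_univ, true_and, Finset.mem_singleton] at hj
    by_cases h : j = k
    · subst h
      have h1 : v j ≠ w j := hj.2 rfl
      simp only [Pi.add_apply, Pi.single_eq_same]
      exact zmod2_ne _ _ h1
    · have h1 : v j = w j := by
        by_contra h2; exact h (hj.1 h2)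
      simp [h, h1]
  · rintro ⟨k, rfl⟩
    refine ⟨k, ?_⟩
    ext j
    by_cases h : j = k
    · subst h; simp
    · simp [h]

lemma ncard_eq_nbc {n : ℕ} (v : BW n) (A : Set (BW n)) :
    {w | w ∈ A ∧ hAdj v w}.ncard = nbc v A := by
  classical
  have hinj : Function.Injective (fun k : Fin n => v + (Pi.single k 1 : BW n)) := by
    intro k l h
    have h2 : (Pi.single k 1 : BW n) = Pi.single l 1 := add_left_cancel h
    by_contra hkl
    have := congrFun h2 k
    simp [hkl] at this
  have : {w | w ∈ A ∧ hAdj v w} =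
      (((Finset.univ.filter (fun k : Fin n => v + Pi.single k 1 ∈ A)).image
        (fun k : Fin n => v + (Pi.single k 1 : BW n)) : Finset (BW n)) : Set (BW n)) := by
    ext w
    simp only [Set.mem_ofPred_eq, hAdj_iff, Finset.coe_image, Finset.coe_filter, Finset.mem_univ,
      true_and, Set.mem_image]
    constructor
    · rintro ⟨h, k, rfl⟩; exact ⟨k, h, rfl⟩
    · rintro ⟨k, h, rfl⟩; exact ⟨h, k, rfl⟩
  rw [this, Set.ncard_coe_finset, Finset.card_image_of_injective _ hinj]
  unfold nbc
  congr

lemma bw_add_self {n : ℕ} (x : BW n) : x + x = 0 := by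
  funext j; exact CharTwo.add_self_eq_zero _

open Classical in
lemma nbc_double {n : ℕ} (A B : Set (BW n)) :
    ∑ v ∈ Finset.univ.filter (· ∈ A), nbc v B = ∑ v ∈ Finset.univ.filter (· ∈ B), nbc v A := by
  have key : ∀ A B : Set (BW n), ∑ v ∈ Finset.univ.filter (· ∈ A), nbc v B =
      ∑ k : Fin n, ∑ v : BW n, if v ∈ A ∧ v + Pi.single k 1 ∈ B then 1 else 0 := by
    intro A B
    rw [Finset.sum_comm, Finset.sum_filter]
    refine Finset.sum_congr rfl fun v _ => ?_
    by_cases h : v ∈ A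
    · simp [h, nbc]
    · simp [h]
  rw [key, key]
  refine Finset.sum_congr rfl fun k _ => ?_
  rw [← Equiv.sum_comp (Equiv.addRight (Pi.single k 1 : BW n))]
  refine Finset.sum_congr rfl fun v _ => ?_
  simp only [Equiv.coe_addRight, add_assoc, bw_add_self, add_zero]
  simp only [and_comm]

lemma nbc_shift {n : ℕ} (v e : BW n) (A : Set (BW n)) :
    nbc v {x | x + e ∈ A} = nbc (v + e) A := by
  unfold nbc
  congr 1
  ext k
  simp only [Finset.mem_filter, Set.mem_ofPred_eq, add_right_comm v e]

open Classical in
lemma nbc_three {n : ℕ} (v : BW n) (A B E : Set (BW n))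
    (h : ∀ x, (x ∈ A ∧ x ∉ B ∧ x ∉ E) ∨ (x ∉ A ∧ x ∈ B ∧ x ∉ E) ∨ (x ∉ A ∧ x ∉ B ∧ x ∈ E)) :
    nbc v A + nbc v B + nbc v E = n := by
  unfold nbc
  simp only [Finset.card_filter]
  rw [← Finset.sum_add_distrib, ← Finset.sum_add_distrib]
  trans ∑ k : Fin n, 1
  · refine Finset.sum_congr rfl fun k _ => ?_
    rcases h (v + Pi.single k 1) with h | h | h <;> simp [h]
  · simp

set_option maxHeartbeats 1000000 in
theorem stmt_11 (n r : ℕ) (hn : n = 3 * r) (C : Set (BW n))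
    (hC : IsEquitablePartition hAdj ![C, Cᶜ] ![![0, 3*r], ![r, 2*r]])
    (hsemi : affRank C ≤ n - 1) :
    ∃ C1 C2 C3 : Set (BW n),
      IsEquitablePartition hAdj ![C, C1, C2, C3] (fun i j => if i = j then 0 else r) := by
  classical
  obtain ⟨hne, -, hq⟩ := hC
  obtain ⟨c0, hc0⟩ : C.Nonempty := hne 0
  obtain ⟨d0, hd0⟩ : (Cᶜ).Nonempty := hne 1
  have hrpos : 0 < r := by
    rcases Nat.eq_zero_or_pos r with h | h
    · subst h
      simp only [mul_zero] at hn
      subst hn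
      exact absurd (by rwa [Subsingleton.elim d0 c0]) hd0
    · exact h
  have hCC : ∀ v ∈ C, nbc v C = 0 := fun v hv => by
    rw [← ncard_eq_nbc]; exact hq 0 0 v hv
  have hCn : ∀ v, v ∉ C → nbc v C = r := fun v hv => by
    rw [← ncard_eq_nbc]; exact hq 1 0 v hv
  -- the hyperplane
  have hlt : (affineSpan (ZMod 2) C).direction < ⊤ := by
    rw [lt_top_iff_ne_top]
    intro h
    unfold affRank at hsemi
    rw [h] at hsemi
    simp at hsemi
    omega
  obtain ⟨f, hf0, hf⟩ := Submodule.exists_le_ker_of_lt_top _ hlt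
  have hfC : ∀ x ∈ C, f x = f c0 := by
    intro x hx
    have : x -ᵥ c0 ∈ (affineSpan (ZMod 2) C).direction :=
      AffineSubspace.vsub_mem_direction (mem_affineSpan _ hx) (mem_affineSpan _ hc0)
    have := hf this
    rw [LinearMap.mem_ker, vsub_eq_sub, map_sub, sub_eq_zero] at this
    exact this
  obtain ⟨i, hi⟩ : ∃ i, f (Pi.single i 1) ≠ 0 := by
    by_contra! h
    apply hf0
    apply LinearMap.pi_ext'
    intro i
    ext
    simpa using h i
  have z2 : ∀ a b c : ZMod 2, c ≠ 0 → (a + c ≠ b ↔ a = b) := by decide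
  set D : Set (BW n) := {x | f x = f c0 ∧ x ∉ C} with hD
  set E : Set (BW n) := {x | f x ≠ f c0} with hE
  have hpart : ∀ x, (x ∈ C ∧ x ∉ D ∧ x ∉ E) ∨ (x ∉ C ∧ x ∈ D ∧ x ∉ E) ∨
      (x ∉ C ∧ x ∉ D ∧ x ∈ E) := by
    intro x
    have := hfC x
    simp only [hD, hE, Set.mem_ofPred_eq]
    tauto
  have h3 := fun v => nbc_three v C D E hpart
  set w := (Finset.univ.filter (fun k : Fin n => f (Pi.single k 1) ≠ 0)).card with hw
  have hEH : ∀ v, f v = f c0 → nbc v E = w := by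
    intro v hv
    rw [hw]
    unfold nbc
    congr 1
    ext k
    simp [hE, map_add, hv]
  have hEE : ∀ v ∈ E, nbc v E + w = n := by
    intro v hv
    have hv' : f v ≠ f c0 := hv
    have : ∀ k : Fin n, v + Pi.single k 1 ∈ E ↔ ¬ (f (Pi.single k 1) ≠ 0) := by
      intro k
      simp only [hE, Set.mem_ofPred_eq, map_add]
      exact zmod2_ne3 _ _ _ hv'
    rw [hw]
    unfold nbc
    simp only [this]
    rw [add_comm, Finset.card_filter_add_card_filter_not]
    simp
  -- double counting
  set FC := Finset.univ.filter (· ∈ C) with hFC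
  set FD := Finset.univ.filter (· ∈ D) with hFD
  set FE := Finset.univ.filter (· ∈ E) with hFE
  have e1 : FE.card * r = FC.card * w := by
    have : ∑ v ∈ FE, nbc v C = ∑ v ∈ FC, nbc v E := by convert nbc_double E C
    rw [Finset.sum_congr rfl (g := fun _ => r), Finset.sum_congr (s₁ := FC) rfl (g := fun _ => w)]
      at this
    · simpa using this
    · intro v hv
      exact hEH v (hfC v (by simpa [hFC] using hv))
    · intro v hv
      have hv : v ∈ E := by simpa [hFE] using hv
      apply hCn
      rcases hpart v with h | h | h <;> tauto
  have e2 : FD.card * r + FC.card * w = FC.card * n := by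
    have : ∑ v ∈ FD, nbc v C = ∑ v ∈ FC, nbc v D := by convert nbc_double D C
    rw [Finset.sum_congr rfl (g := fun _ => r)] at this
    · simp only [Finset.sum_const, smul_eq_mul] at this
      rw [this, ← smul_eq_mul, ← Finset.sum_const, ← Finset.sum_add_distrib, ← smul_eq_mul,
        ← Finset.sum_const]
      refine Finset.sum_congr rfl fun v hv => ?_
      have hv : v ∈ C := by simpa [hFC] using hv
      have a1 := h3 v
      have a2 := hCC v hv
      have a3 := hEH v (hfC v hv)
      omega
    · intro v hv
      have hv : v ∈ D := by simpa [hFD] using hv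
      exact hCn v hv.2
  have flipE : ∀ v, v + Pi.single i 1 ∈ E ↔ f v = f c0 := by
    intro v
    simp only [hE, Set.mem_ofPred_eq, map_add]
    exact z2 _ _ _ hi
  have e3 : FE.card = FC.card + FD.card := by
    rw [hFC, hFD, hFE]
    simp only [Finset.card_filter]
    rw [← Finset.sum_add_distrib, ← Equiv.sum_comp (Equiv.addRight (Pi.single i 1 : BW n))]
    refine Finset.sum_congr rfl fun v _ => ?_
    have h1 := flipE v
    simp only [Equiv.coe_addRight, h1]
    have h2 : f v = f c0 ↔ v ∉ E := by simp [hE]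
    simp only [h2]
    rcases hpart v with h | h | h <;> simp [h]
  have hFCpos : 0 < FC.card := Finset.card_pos.2 ⟨c0, by simpa [hFC] using hc0⟩
  have hw2 : w = 2 * r := by
    have : FC.card * (2 * w) = FC.card * (4 * r) := by
      rw [e3] at e1
      have e4 : FC.card * n = FC.card * (3 * r) := congrArg _ hn
      linarith
    have := Nat.eq_of_mul_eq_mul_left hFCpos this
    omega
  have hDC : ∀ v ∈ C, nbc v D = r := by
    intro v hv
    have a1 := h3 v
    have a2 := hCC v hv
    have a3 := hEH v (hfC v hv)
    omega
  have hDD : ∀ v ∈ D, nbc v D = 0 := by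
    intro v hv
    have a1 := h3 v
    have a2 := hCn v hv.2
    have a3 := hEH v hv.1
    omega
  have hCE : ∀ v ∈ E, nbc v C = r := by
    intro v hv
    apply hCn
    rcases hpart v with h | h | h <;> tauto
  have hDE : ∀ v ∈ E, nbc v D = r := by
    intro v hv
    have a1 := h3 v
    have a2 := hCE v hv
    have a3 := hEE v hv
    omega
  have hCD : ∀ v ∈ D, nbc v C = r := fun v hv => hCn v hv.2
  have hDne : D.Nonempty := by
    by_contra h
    rw [Set.not_nonempty_iff_eq_empty] at h
    have := hDC c0 hc0
    rw [h] at this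
    simp [nbc] at this
    omega
  obtain ⟨d1, hd1⟩ := hDne
  set e : BW n := Pi.single i 1 with he
  have hee : ∀ x : BW n, x + e + e = x := fun x => by rw [add_assoc, bw_add_self, add_zero]
  have toE : ∀ v, v ∈ C ∨ v ∈ D → v + e ∈ E := by
    rintro v (h | h)
    · exact (flipE v).2 (hfC v h)
    · exact (flipE v).2 h.1
  have ofE : ∀ v, v + e ∈ C ∨ v + e ∈ D → v ∈ E := by
    intro v h
    have := toE _ h
    rwa [hee] at this
  have toE' : ∀ v, v ∈ E → v + e ∈ C ∨ v + e ∈ D := by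
    intro v h
    have := flipE (v + e)
    rw [hee] at this
    have h2 := this.1 h
    by_cases h3 : v + e ∈ C
    · exact Or.inl h3
    · exact Or.inr ⟨h2, h3⟩
  refine ⟨D, {x | x + e ∈ C}, {x | x + e ∈ D}, ?_, ?_, ?_⟩
  · intro j
    fin_cases j
    · exact ⟨c0, hc0⟩
    · exact ⟨d1, hd1⟩
    · exact ⟨c0 + e, by simpa [hee] using hc0⟩
    · exact ⟨d1 + e, by show d1 + e + e ∈ D; rwa [hee]⟩
  · intro v
    have p1 := hpart v
    have p2 := hpart (v + e)
    have p3 := toE' v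
    have p4 := ofE v
    have := fin4_unique (v ∈ C) (v ∈ D) (v + e ∈ C) (v + e ∈ D) (by tauto)
    convert this using 2 with j
    fin_cases j <;> rfl
  · intro a b v hv
    rw [ncard_eq_nbc]
    fin_cases a <;> fin_cases b
    · exact hCC v hv
    · exact hDC v hv
    · exact (nbc_shift v e C).trans (hCE _ (toE v (Or.inl hv)))
    · exact (nbc_shift v e D).trans (hDE _ (toE v (Or.inl hv)))
    · exact hCD v hv
    · exact hDD v hv
    · exact (nbc_shift v e C).trans (hCE _ (toE v (Or.inr hv)))
    · exact (nbc_shift v e D).trans (hDE _ (toE v (Or.inr hv)))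
    · exact hCE v (ofE v (Or.inl hv))
    · exact hDE v (ofE v (Or.inl hv))
    · exact (nbc_shift v e C).trans (hCC _ hv)
    · exact (nbc_shift v e D).trans (hDC _ hv)
    · exact hCE v (ofE v (Or.inr hv))
    · exact hDE v (ofE v (Or.inr hv))
    · exact (nbc_shift v e C).trans (hCD _ hv)
    · exact (nbc_shift v e D).trans (hDD _ hv)
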